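/- Let (H₊, H₀, H₋) be a quasi Gelfand triple of Hilbert spaces with embeddings ι₊, ι₋ and unitary Ψ. Then ι₊ᴴ = Ψ ∘ ι₋⁻¹ and ι₋ᴴ = Ψ⁻¹ ∘ ι₊⁻¹; explicitly: dom ι₊ᴴ = ran ι₋ and ι₊ᴴ(ι₋ g) = Ψ g for every g ∈ dom ι₋, and dom ι₋ᴴ = ran ι₊ and ι₋ᴴ(ι₊ f) = Ψ⁻¹ f for every f ∈ dom ι₊. -/

import Mathlib

open scoped InnerProductSpace LinearPMap

/-- A closed, densely defined operator `T` contains every pair that is formally adjoint to `T†`,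
i.e. `T†† ≤ T` on the level of graphs. -/
theorem LinearPMap.IsClosed.mem_graph_of_inner_adjoint {𝕜 E F : Type*} [RCLike 𝕜]
    [NormedAddCommGroup E] [InnerProductSpace 𝕜 E] [CompleteSpace E]
    [NormedAddCommGroup F] [InnerProductSpace 𝕜 F] [CompleteSpace F]
    {T : E →ₗ.[𝕜] F} (hT : Dense (T.domain : Set E)) (hc : T.IsClosed) {x : E} {y : F}
    (h : ∀ z : T†.domain, inner 𝕜 (T† z) x = inner 𝕜 (z : F) y) : (x, y) ∈ T.graph := by
  let L : Submodule 𝕜 (WithLp 2 (E × F)) :=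
    T.graph.comap (WithLp.linearEquiv 2 𝕜 (E × F)).toLinearMap
  have hL : _root_.IsClosed (L : Set (WithLp 2 (E × F))) :=
    hc.preimage (WithLp.prod_continuous_ofLp 2 E F)
  have : CompleteSpace L := hL.completeSpace_coe
  suffices hxy : WithLp.toLp 2 (x, y) ∈ L from hxy
  rw [← L.orthogonal_orthogonal, Submodule.mem_orthogonal]
  intro u hu
  have key (e : T.domain) : inner 𝕜 (-u.fst) (e : E) = inner 𝕜 u.snd (T e) := by
    have h0 := (Submodule.mem_orthogonal' L u).1 hu (WithLp.toLp 2 ((e : E), T e)) (T.mem_graph e)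
    rw [WithLp.prod_inner_apply] at h0
    rw [inner_neg_left]
    exact neg_eq_of_add_eq_zero_right h0
  have hz := h ⟨u.snd, LinearPMap.mem_adjoint_domain_of_exists _ ⟨_, key⟩⟩
  rw [LinearPMap.adjoint_apply_eq hT _ key, inner_neg_left] at hz
  rw [WithLp.prod_inner_apply]
  exact neg_eq_iff_add_eq_zero.1 hz

/-- In a quasi Gelfand triple `(H₊, H₀, H₋)` with embeddings `ι₊`, `ι₋` and
unitary `Ψ` one has `ι₊ᴴ = Ψ ∘ ι₋⁻¹` and `ι₋ᴴ = Ψ⁻¹ ∘ ι₊⁻¹`; explicitly, `dom ι₊ᴴ = ran ι₋` with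
`ι₊ᴴ (ι₋ g) = Ψ g` for `g ∈ dom ι₋`, and `dom ι₋ᴴ = ran ι₊` with `ι₋ᴴ (ι₊ f) = Ψ⁻¹ f` for
`f ∈ dom ι₊`. -/
theorem stmt6 {Hp H0 Hm : Type*}
    [NormedAddCommGroup Hp] [InnerProductSpace ℂ Hp] [CompleteSpace Hp]
    [NormedAddCommGroup H0] [InnerProductSpace ℂ H0] [CompleteSpace H0]
    [NormedAddCommGroup Hm] [InnerProductSpace ℂ Hm] [CompleteSpace Hm]
    (Ψ : Hm ≃ₗᵢ[ℂ] Hp)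
    (ιp : Hp →ₗ.[ℂ] H0) (ιm : Hm →ₗ.[ℂ] H0)
    (hpDense : Dense (ιp.domain : Set Hp))
    (hmDense : Dense (ιm.domain : Set Hm))
    (hpClosed : ιp.IsClosed) (hmClosed : ιm.IsClosed)
    (hpInj : ∀ x y : ιp.domain, ιp x = ιp y → (x : Hp) = (y : Hp))
    (hmInj : ∀ x y : ιm.domain, ιm x = ιm y → (x : Hm) = (y : Hm))
    (hpRan : Dense (Set.range fun f : ιp.domain => ιp f))
    (hmRan : Dense (Set.range fun g : ιm.domain => ιm g))
    (compat : ∀ (f : ιp.domain) (g : ιm.domain),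
      (⟪ιp f, ιm g⟫_ℂ) = ⟪(f : Hp), Ψ (g : Hm)⟫_ℂ)
    (hquasi : ((ιp†).domain : Set H0) = Set.range fun g : ιm.domain => ιm g) :
    (((ιp†).domain : Set H0) = Set.range fun g : ιm.domain => ιm g) ∧
      (∀ (g : ιm.domain) (h : ιm g ∈ (ιp†).domain), ιp† ⟨ιm g, h⟩ = Ψ (g : Hm)) ∧
      (((ιm†).domain : Set H0) = Set.range fun f : ιp.domain => ιp f) ∧
      (∀ (f : ιp.domain) (h : ιp f ∈ (ιm†).domain), ιm† ⟨ιp f, h⟩ = Ψ.symm (f : Hp)) := by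
  have compat' (f : ιp.domain) (g : ιm.domain) :
      ⟪Ψ (g : Hm), (f : Hp)⟫_ℂ = ⟪ιm g, ιp f⟫_ℂ := by
    rw [← inner_conj_symm, ← compat f g, inner_conj_symm]
  have hp_apply (g : ιm.domain) (h : ιm g ∈ (ιp†).domain) : ιp† ⟨ιm g, h⟩ = Ψ (g : Hm) :=
    LinearPMap.adjoint_apply_eq hpDense _ fun f => compat' f g
  have hm_formal (f : ιp.domain) (g : ιm.domain) :
      ⟪Ψ.symm (f : Hp), (g : Hm)⟫_ℂ = ⟪ιp f, ιm g⟫_ℂ := by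
    rw [compat, ← Ψ.inner_map_map, Ψ.apply_symm_apply]
  refine ⟨hquasi, hp_apply, Set.Subset.antisymm (fun y hy => ?_) ?_,
    fun f h => LinearPMap.adjoint_apply_eq hmDense _ (hm_formal f)⟩
  · have hmem : (Ψ (ιm† ⟨y, hy⟩), y) ∈ ιp.graph := by
      refine hpClosed.mem_graph_of_inner_adjoint hpDense ?_
      rintro ⟨z, hz⟩
      obtain ⟨g, rfl⟩ := hquasi.subset hz
      rw [hp_apply g hz, Ψ.inner_map_map]
      exact ((LinearPMap.adjoint_isFormalAdjoint hmDense).symm g ⟨y, hy⟩).symm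
    obtain ⟨f, -, hf⟩ := (LinearPMap.mem_graph_iff _).1 hmem
    exact ⟨f, hf⟩
  · rintro _ ⟨f, rfl⟩
    exact LinearPMap.mem_adjoint_domain_of_exists _ ⟨_, hm_formal f⟩
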